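/- Let n be a positive integer and r an arbitrary integer. Then in the field of rational functions ℚ(q), the sum ∑_{k=0}^{n-1} q^{r(n-k)^2+(r-1)k} · [n+k choose k]_q^{2r} · [n-1 choose k]_q^{2r} is congruent to q^{(r-1)n+1}·[n] − (r(2r-1)(n-1)^2/4)·q·(1-q)^2·[n]^3 modulo [n]·Φ_n(q)^3. -/

import Mathlib

open Finset Polynomial

/-- The variable `q` of the field of rational functions `ℚ(q)`. -/
noncomputable def q : RatFunc ℚ := RatFunc.X

/-- The `q`-shifted factorial `(q;q)_m = ∏_{i=1}^{m} (1 - q^i)` as an element of `ℚ(q)`. -/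
noncomputable def qPoch (m : ℕ) : RatFunc ℚ := ∏ i ∈ Finset.range m, (1 - q ^ (i + 1))

/-- The Gaussian `q`-binomial coefficient `[m choose k]_q`, viewed in `ℚ(q)`. -/
noncomputable def qbinom (m k : ℕ) : RatFunc ℚ :=
  if k ≤ m then qPoch m / (qPoch k * qPoch (m - k)) else 0

/-- The `q`-integer `[n] = 1 + q + ⋯ + q^{n-1}` as a polynomial in `ℚ[q]`. -/
noncomputable def qint (n : ℕ) : Polynomial ℚ := ∑ i ∈ Finset.range n, Polynomial.X ^ i

/-- The `q`-integer `[n]` viewed in `ℚ(q)`. -/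
noncomputable def qintR (n : ℕ) : RatFunc ℚ :=
  algebraMap (Polynomial ℚ) (RatFunc ℚ) (qint n)

/-- `A ≡ B (mod P)` for rational functions `A, B ∈ ℚ(q)` and a polynomial `P`:
`A - B` can be written as a fraction `a / b` of polynomials whose numerator `a` is
divisible by `P` and whose denominator `b` is coprime to `P`. -/
def ratModEq (P : Polynomial ℚ) (A B : RatFunc ℚ) : Prop :=
  ∃ a b : Polynomial ℚ, IsCoprime b P ∧ P ∣ a ∧
    A - B = algebraMap (Polynomial ℚ) (RatFunc ℚ) a / algebraMap (Polynomial ℚ) (RatFunc ℚ) b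

section NilpotentExpansion

variable {A : Type*} [CommRing A]

theorem one_sub_mul_sum_mul_pow (z : A) (n : ℕ) :
    (1 - z) * ∑ k ∈ range (n + 1), (k : A) * z ^ k =
      (∑ k ∈ range (n + 1), z ^ k) - 1 - n * z ^ (n + 1) := by
  induction n with
  | zero => simp
  | succ n ih =>
    rw [sum_range_succ, mul_add, ih, sum_range_succ _ (n + 1)]
    push_cast
    ring

theorem sum_mul_sub_mul_succ (z : A) (n : ℕ) :
    ∑ k ∈ range (n + 1), (k : A) * ((n + 1 : ℕ) - k) * z ^ k =
      ∑ k ∈ range n, (k : A) * (n - k) * z ^ k + ∑ k ∈ range (n + 1), (k : A) * z ^ k := by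
  rw [sum_range_succ, sum_range_succ (fun k => (k : A) * z ^ k), ← add_assoc, ← sum_add_distrib]
  congr 1
  · refine sum_congr rfl fun k _ => ?_
    push_cast
    ring
  · push_cast
    ring

theorem one_sub_sq_mul_sum_mul_sub_mul_pow (z : A) (n : ℕ) :
    (1 - z) ^ 2 * ∑ k ∈ range n, (k : A) * (n - k) * z ^ k =
      (n + 1) * z + (n - 1) * z ^ (n + 1) - 2 * z * ∑ k ∈ range n, z ^ k := by
  induction n with
  | zero => simp
  | succ n ih =>
    have h := one_sub_mul_sum_mul_pow z n
    have hg := mul_neg_geom_sum z (n + 1)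
    rw [sum_mul_sub_mul_succ, mul_add, ih]
    rw [sum_range_succ (fun k => z ^ k)] at hg h ⊢
    push_cast
    linear_combination (1 - z) * h + hg

theorem six_mul_sum_mul_sub (n : ℕ) :
    6 * ∑ k ∈ range n, (k : A) * (n - k) = n * (n ^ 2 - 1) := by
  have h1 : ∀ m : ℕ, 2 * ∑ k ∈ range (m + 1), (k : A) = m * (m + 1) := by
    intro m
    induction m with
    | zero => simp
    | succ m ih => rw [sum_range_succ, mul_add, ih]; push_cast; ring
  induction n with
  | zero => simp
  | succ n ih =>
    have h2 := sum_mul_sub_mul_succ (1 : A) n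
    simp only [one_pow, mul_one] at h2
    rw [h2, mul_add, ih]
    push_cast
    linear_combination 3 * h1 n

theorem isUnit_natCast_of_algebra_rat [Algebra ℚ A] {m : ℕ} (hm : m ≠ 0) : IsUnit (m : A) := by
  have h : IsUnit (algebraMap ℚ A m) := (IsUnit.mk0 (m : ℚ) (by exact_mod_cast hm)).map _
  simpa using h

theorem twelve_mul_sum_inv_sq [Algebra ℚ A] {x : A} {n : ℕ} (hn : 0 < n) {w : ℕ → Aˣ}
    (hw : ∀ j, 0 < j → j < n → (w j : A) = 1 - x ^ j) {t : A} (ht : t * (1 - x ^ n) = 0) :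
    t * (12 * ∑ i ∈ range (n - 1), x ^ (i + 1) * ((w (i + 1))⁻¹ : Aˣ) ^ 2 + (n ^ 2 - 1)) = 0 := by
  have hpow : ∀ k, t * (1 - x ^ (n * k)) = 0 := by
    intro k
    rw [pow_mul, ← mul_neg_geom_sum, ← mul_assoc, ht, zero_mul]
  have hgeom : ∀ k, 0 < k → k < n → t * ∑ i ∈ range n, (x ^ k) ^ i = 0 := by
    intro k hk hkn
    have h := mul_neg_geom_sum (x ^ k) n
    rw [← hw k hk hkn, ← pow_mul, mul_comm k n] at h
    refine (w k).isUnit.mul_left_cancel ?_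
    linear_combination t * h + hpow k
  have hT : ∀ j, 0 < j → j < n → t * ∑ k ∈ range n, (k : A) * (n - k) * (x ^ j) ^ k =
      t * (2 * n * (x ^ j * ((w j)⁻¹ : Aˣ) ^ 2)) := by
    intro j hj hjn
    have h := one_sub_sq_mul_sum_mul_sub_mul_pow (x ^ j) n
    rw [← hw j hj hjn] at h
    have hg := hgeom j hj hjn
    have hp := hpow j
    have h2 := (w j).mul_inv
    refine ((w j).isUnit.pow 2).mul_left_cancel ?_
    have h3 : (x ^ j) ^ (n + 1) = x ^ j * x ^ (n * j) := by ring
    rw [h3] at h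
    linear_combination t * h - 2 * x ^ j * hg - (n - 1) * x ^ j * hp -
      t * 2 * n * x ^ j * ((w j : A) * ((w j)⁻¹ : Aˣ) + 1) * h2
  have hswap : t * ∑ i ∈ range (n - 1), ∑ k ∈ range n, (k : A) * (n - k) * (x ^ (i + 1)) ^ k =
      - (t * ∑ k ∈ range n, (k : A) * (n - k)) := by
    rw [sum_comm, mul_sum, mul_sum, ← sum_neg_distrib]
    refine sum_congr rfl fun k hk => ?_
    rcases Nat.eq_zero_or_pos k with rfl | hk0
    · simp
    · have h := hgeom k hk0 (mem_range.1 hk)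
      obtain ⟨m, rfl⟩ : ∃ m, n = m + 1 := ⟨n - 1, by omega⟩
      rw [sum_range_succ'] at h
      have h4 : ∀ i, (x ^ (i + 1)) ^ k = (x ^ k) ^ (i + 1) := fun i => by ring
      simp only [h4, ← mul_sum, Nat.add_sub_cancel]
      linear_combination ((k : A) * ((m + 1 : ℕ) - k)) * h
  have hsum : t * ∑ i ∈ range (n - 1), ∑ k ∈ range n, (k : A) * (n - k) * (x ^ (i + 1)) ^ k =
      t * (2 * n * ∑ i ∈ range (n - 1), x ^ (i + 1) * ((w (i + 1))⁻¹ : Aˣ) ^ 2) := by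
    rw [mul_sum, mul_sum, mul_sum]
    exact sum_congr rfl fun i hi => hT (i + 1) i.succ_pos (by have := mem_range.1 hi; omega)
  refine (isUnit_natCast_of_algebra_rat (A := A) hn.ne').mul_left_cancel ?_
  linear_combination 6 * hswap - 6 * hsum - t * six_mul_sum_mul_sub (A := A) n

theorem sq_mul_inv_add_inv {z e : A} {v w : Aˣ} (he : e ^ 4 = 0) (hv : (v : A) = 1 - z)
    (hw : (w : A) * z = e - v) :
    e ^ 2 * ((v⁻¹ : Aˣ) + (w⁻¹ : Aˣ) - 1 + e * (z * (v⁻¹ : Aˣ) ^ 2)) = 0 := by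
  have h1 := v.mul_inv
  have h2 := w.mul_inv
  rw [hv] at h1 hw
  generalize ((v⁻¹ : Aˣ) : A) = a at *
  generalize ((w⁻¹ : Aˣ) : A) = b at *
  have h3 : b * (e * a - 1) = z * a := by
    linear_combination -a * b * hw + z * a * h2 + b * h1
  linear_combination (a ^ 2 * b) * he + e ^ 2 * h1 - e ^ 2 * (1 + e * a) * h3

theorem zpow_eq_of_sq_eq_zero {u h : A} (hu : u ^ 2 = 0) {g : Aˣ} (hg : (g : A) = 1 - u * h)
    (m : ℤ) : ((g ^ m : Aˣ) : A) = 1 - m * u * h := by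
  have hi : ((g⁻¹ : Aˣ) : A) = 1 + u * h := by
    have h1 := g.mul_inv
    rw [hg] at h1
    linear_combination (1 + u * h) * h1 + ((g⁻¹ : Aˣ) : A) * h ^ 2 * hu
  induction m using Int.induction_on with
  | zero => simp
  | succ k ih =>
    rw [zpow_add_one, Units.val_mul, ih, hg]; push_cast; linear_combination k * h ^ 2 * hu
  | pred k ih =>
    rw [zpow_sub_one, Units.val_mul, ih, hi]; push_cast; linear_combination k * h ^ 2 * hu

theorem prod_eq_of_sq_eq_zero {u : A} (hu : u ^ 2 = 0) (v : ℕ → A) (k : ℕ) :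
    ∏ i ∈ range k, (1 - u * v i) = 1 - u * ∑ i ∈ range k, v i := by
  induction k with
  | zero => simp
  | succ k ih =>
    rw [prod_range_succ, ih, sum_range_succ]
    linear_combination (∑ i ∈ range k, v i) * v k * hu

theorem two_mul_zpow_of_pow_four_eq_zero {e : A} (he : e ^ 4 = 0) {Q : Aˣ} (hQ : (Q : A) = 1 - e)
    (m : ℤ) : 2 * e * ((Q ^ m : Aˣ) : A) = 2 * e - 2 * m * e ^ 2 + m * (m - 1) * e ^ 3 := by
  have hi : e * ((Q⁻¹ : Aˣ) : A) = e * (1 + e + e ^ 2) := by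
    have h1 := Q.mul_inv
    rw [hQ] at h1
    linear_combination e * (1 + e + e ^ 2) * h1 + ((Q⁻¹ : Aˣ) : A) * he
  induction m using Int.induction_on with
  | zero => simp
  | succ k ih =>
    rw [zpow_add_one, Units.val_mul, ← mul_assoc, ih, hQ]; push_cast
    linear_combination (-k * (k - 1) : A) * he
  | pred k ih =>
    rw [zpow_sub_one, Units.val_mul, ← mul_assoc, ih]; push_cast
    linear_combination (2 + 2 * k * e + k * (k + 1) * e ^ 2 : A) * hi +
       (2 * k + k * (k + 1) * (1 + e) : A) * he

theorem one_sub_mul_sum_inv_pow_mul_sum (x : Aˣ) (v : ℕ → A) (m : ℕ) :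
    (1 - (x : A)) * ∑ k ∈ range (m + 1), ((x⁻¹ : Aˣ) : A) ^ k * ∑ i ∈ range k, v i =
      ((x⁻¹ : Aˣ) : A) ^ m * ∑ i ∈ range m, v i - ∑ i ∈ range m, ((x⁻¹ : Aˣ) : A) ^ i * v i := by
  induction m with
  | zero => simp
  | succ m ih =>
    rw [sum_range_succ, mul_add, ih, sum_range_succ _ m, sum_range_succ _ m]
    linear_combination (-((x⁻¹ : Aˣ) : A) ^ m * (∑ i ∈ range m, v i + v m)) * x.mul_inv

theorem one_sub_mul_sum_inv_pow (x : Aˣ) (m : ℕ) :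
    (1 - (x : A)) * ∑ k ∈ range (m + 1), ((x⁻¹ : Aˣ) : A) ^ k = ((x⁻¹ : Aˣ) : A) ^ m - x := by
  induction m with
  | zero => simp
  | succ m ih =>
    rw [sum_range_succ, mul_add, ih]
    linear_combination (-((x⁻¹ : Aˣ) : A) ^ m) * x.mul_inv

theorem sum_inv_pow_mul_prod_zpow [Algebra ℚ A] {n : ℕ} (hn : 2 ≤ n) (r : ℤ) {x : Aˣ} {N : A}
    {w f : ℕ → Aˣ} (he : (1 - (x : A) ^ n) ^ 4 = 0) (hN : (1 - (x : A)) * N = 1 - (x : A) ^ n)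
    (hw : ∀ j, 0 < j → j < n → (w j : A) = 1 - (x : A) ^ j)
    (hf : ∀ j, 0 < j → j < n → (f j : A) =
      1 - (1 - (x : A) ^ n) ^ 2 * ((x ^ n)⁻¹ : Aˣ) * ((x : A) ^ j * ((w j)⁻¹ : Aˣ) ^ 2)) :
    ((x ^ (r * (n : ℤ) ^ 2) : Aˣ) : A) * ∑ k ∈ range n,
        ((x⁻¹ : Aˣ) : A) ^ k * (((∏ i ∈ range k, f (i + 1)) ^ (2 * r) : Aˣ) : A) =
      ((x ^ ((r - 1) * (n : ℤ) + 1) : Aˣ) : A) * N -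
        algebraMap ℚ A (((r * (2 * r - 1) * ((n : ℤ) - 1) ^ 2 : ℤ) : ℚ) / 4) *
          x * (1 - x) ^ 2 * N ^ 3 := by
  have hH := twelve_mul_sum_inv_sq (A := A) (by omega) hw
    (t := (1 - (x : A) ^ n) ^ 3) (by linear_combination he)
  have hW : (1 - (x : A) ^ n) ^ 2 * (2 * ∑ i ∈ range (n - 1), (((w (i + 1))⁻¹ : Aˣ) : A) - (n - 1) +
      (1 - (x : A) ^ n) *
        ∑ i ∈ range (n - 1), (x : A) ^ (i + 1) * ((w (i + 1))⁻¹ : Aˣ) ^ 2) = 0 := by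
    have hrefl := sum_range_reflect (fun i => (((w (i + 1))⁻¹ : Aˣ) : A)) (n - 1)
    have hcard : ∑ i ∈ range (n - 1), (1 : A) = n - 1 := by
      rw [sum_const, card_range, nsmul_one, Nat.cast_sub (by omega), Nat.cast_one]
    rw [two_mul]
    nth_rewrite 2 [← hrefl]
    rw [← hcard, mul_sum, ← sum_add_distrib, ← sum_sub_distrib, ← sum_add_distrib, mul_sum]
    refine sum_eq_zero fun i hi => ?_
    have hi' := mem_range.1 hi
    have hij : n - 1 - 1 - i + 1 + (i + 1) = n := by omega
    refine sq_mul_inv_add_inv he (hw (i + 1) (by omega) (by omega)) ?_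
    rw [hw (i + 1) (by omega) (by omega), hw _ (by omega) (by omega), sub_mul, ← pow_add, hij]
    ring
  obtain ⟨m, rfl⟩ : ∃ m, n = m + 1 := ⟨n - 1, by omega⟩
  rw [Nat.add_sub_cancel] at hH hW
  set Q : Aˣ := x ^ (m + 1) with hQdef
  obtain ⟨e, hQe⟩ : ∃ e : A, e = 1 - (x : A) ^ (m + 1) := ⟨_, rfl⟩
  rw [← hQe] at he hN hH hW hf
  have hQe' : (Q : A) = 1 - e := by rw [hQe, hQdef]; push_cast; ring
  have hQg := Q.mul_inv
  set v : ℕ → A := fun i => (x : A) ^ (i + 1) * ((w (i + 1))⁻¹ : Aˣ) ^ 2 with hv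
  set H : A := ∑ i ∈ range m, v i with hHdef
  set W : A := ∑ i ∈ range m, (((w (i + 1))⁻¹ : Aˣ) : A) with hWdef
  set g : A := ((Q⁻¹ : Aˣ) : A) with hg
  set u : A := e ^ 2 * g with hu
  have hu2 : u ^ 2 = 0 := by rw [hu]; linear_combination g ^ 2 * he
  have hP : ∀ k ∈ range (m + 1), ((x⁻¹ : Aˣ) : A) ^ k *
      (((∏ i ∈ range k, f (i + 1)) ^ (2 * r) : Aˣ) : A) =
      ((x⁻¹ : Aˣ) : A) ^ k - 2 * r * u * (((x⁻¹ : Aˣ) : A) ^ k * ∑ i ∈ range k, v i) := by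
    intro k hk
    have hk' := mem_range.1 hk
    have hprod : ((∏ i ∈ range k, f (i + 1) : Aˣ) : A) = 1 - u * ∑ i ∈ range k, v i := by
      rw [← prod_eq_of_sq_eq_zero hu2, Units.coe_prod]
      refine prod_congr rfl fun i hi => ?_
      have := mem_range.1 hi
      exact hf (i + 1) (by omega) (by omega)
    rw [zpow_eq_of_sq_eq_zero hu2 hprod]
    push_cast
    ring
  rw [sum_congr rfl hP, sum_sub_distrib, ← mul_sum]
  have h1 := one_sub_mul_sum_inv_pow x m
  have h2 := one_sub_mul_sum_inv_pow_mul_sum x v m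
  have h3 : ∑ i ∈ range m, ((x⁻¹ : Aˣ) : A) ^ i * v i = x * (H + W) := by
    rw [hHdef, hWdef, ← sum_add_distrib, mul_sum]
    refine sum_congr rfl fun i hi => ?_
    have hwi := hw (i + 1) (by omega) (by have := mem_range.1 hi; omega)
    have h4 := (w (i + 1)).mul_inv
    have h5 : ((x⁻¹ : Aˣ) : A) ^ i * (x : A) ^ i = 1 := by
      rw [← mul_pow, x.inv_mul, one_pow]
    rw [hwi] at h4
    simp only [hv]
    generalize (((w (i + 1))⁻¹ : Aˣ) : A) = a at *
    linear_combination a ^ 2 * x * h5 + a * x * h4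
  have h6 : ((x⁻¹ : Aˣ) : A) ^ m = x * g := by
    rw [hg, hQdef, ← Units.val_pow_eq_pow_val, ← Units.val_mul]
    congr 1
    group
  rw [h3, h6] at h2
  rw [h6] at h1
  have h7 : x ^ (r * ((m + 1 : ℕ) : ℤ) ^ 2) = Q ^ (r * m) * Q ^ (r - 1) * Q := by
    rw [hQdef, ← zpow_natCast, ← zpow_mul, ← zpow_mul, ← zpow_add, ← zpow_add]
    congr 1
    push_cast
    ring
  have h8 : x ^ ((r - 1) * ((m + 1 : ℕ) : ℤ) + 1) = Q ^ (r - 1) * x := by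
    rw [hQdef, ← zpow_natCast, ← zpow_mul, ← zpow_add_one]
    congr 1
    ring
  have h9 := two_mul_zpow_of_pow_four_eq_zero he hQe' (r * m)
  have h10 := two_mul_zpow_of_pow_four_eq_zero he hQe' (r - 1)
  have h11 : 4 * algebraMap ℚ A (((r * (2 * r - 1) * (((m + 1 : ℕ) : ℤ) - 1) ^ 2 : ℤ) : ℚ) / 4) =
      r * (2 * r - 1) * (m : A) ^ 2 := by
    have h4 : (4 : A) = algebraMap ℚ A 4 := (map_ofNat _ 4).symm
    rw [h4, ← map_mul, mul_div_cancel₀ _ (by norm_num), map_intCast]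
    push_cast
    ring
  rw [h7, h8]
  generalize algebraMap ℚ A _ = c at *
  simp only [Units.val_mul]
  generalize ((Q ^ (r * m) : Aˣ) : A) = X at *
  generalize ((Q ^ (r - 1) : Aˣ) : A) = Y at *
  have hB : 4 * (e - 2 * r * u * (e * H - Q * W)) =
      4 * e + 4 * r * m * e ^ 2 + r * ((m + 1) ^ 2 - 1) * e ^ 3 := by
    rw [hQe'] at hQg ⊢
    push_cast at hH hW
    rw [hu]
    linear_combination (8 * r * e ^ 2 * W - 8 * r * H * e ^ 3) * hQg - 8 * r * H * g * he +
      4 * r * hW - r * hH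
  have hXB : 2 * X * (4 * e + 4 * r * m * e ^ 2 + r * ((m + 1) ^ 2 - 1) * e ^ 3) =
      8 * e - 2 * (r * (2 * r - 1) * m ^ 2) * e ^ 3 := by
    push_cast at h9
    linear_combination (4 + 4 * r * m * e + r * ((m + 1) ^ 2 - 1) * e ^ 2) * h9 +
      (-2 * (r * m) * (r * ((m + 1) ^ 2 - 1)) + 4 * (r * m) ^ 2 * (r * m - 1) +
        r * m * (r * m - 1) * (r * ((m + 1) ^ 2 - 1)) * e) * he
  have hY : 2 * (e ^ 3 * Y) = 2 * e ^ 3 := by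
    linear_combination e ^ 2 * h10 + (-2 * ((r - 1 : ℤ) : A) +
      ((r - 1 : ℤ) : A) * (((r - 1 : ℤ) : A) - 1) * e) * he
  have h8u : IsUnit (8 * (1 - (x : A))) := by
    have h := hw 1 one_pos (by omega)
    rw [pow_one] at h
    rw [← h]
    exact (by simpa using isUnit_natCast_of_algebra_rat (A := A) (m := 8) (by norm_num) :
      IsUnit (8 : A)).mul (w 1).isUnit
  have hN3 : ((1 - (x : A)) * N) ^ 3 = e ^ 3 := by rw [hN]
  refine h8u.mul_left_cancel ?_
  linear_combination 8 * X * Y * Q * h1 - 16 * r * u * X * Y * Q * h2 +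
    8 * X * Y * x * (1 - 2 * r * u * H) * hQg - 8 * X * Y * x * hQe' + 2 * X * Y * x * hB +
    Y * x * hXB - r * (2 * r - 1) * m ^ 2 * x * hY + 2 * e ^ 3 * x * h11 - 8 * Y * x * hN +
    8 * c * x * hN3 + 16 * r * u * H * X * Y * x * hQe'

theorem sum_inv_pow_mul_prod_zpow_eq_zero {x : Aˣ} {f : ℕ → Aˣ} {d : ℕ}
    (hx : ∑ i ∈ range d, (x : A) ^ i = 0) (s : ℤ) (l : ℕ)
    (hf : ∀ j < d * l, ¬ d ∣ j → f j = 1) :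
    ∑ k ∈ range (d * l), ((x⁻¹ : Aˣ) : A) ^ k * (((∏ i ∈ range k, f (i + 1)) ^ s : Aˣ) : A) = 0 := by
  have hx' : ∑ i ∈ range d, ((x⁻¹ : Aˣ) : A) ^ i = 0 := by
    rw [← sum_range_reflect] at hx
    refine (x ^ (d - 1)).isUnit.mul_left_cancel ?_
    rw [mul_zero, ← hx, mul_sum]
    refine sum_congr rfl fun i hi => ?_
    have hi' := mem_range.1 hi
    rw [← Units.val_pow_eq_pow_val, ← Units.val_pow_eq_pow_val, ← Units.val_mul, inv_pow,
      ← pow_sub x (by omega)]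
  induction l with
  | zero => simp
  | succ l ih =>
    have hlt : d * l ≤ d * (l + 1) := Nat.mul_le_mul_left d l.le_succ
    rw [mul_add, mul_one, sum_range_add, ih fun j hj => hf j (by omega), zero_add]
    have hP : ∀ t ∈ range d, ∏ i ∈ range (d * l + t), f (i + 1) = ∏ i ∈ range (d * l), f (i + 1) := by
      intro t ht
      rw [prod_range_add]
      refine mul_eq_left.2 (prod_eq_one fun i hi => ?_)
      have h1 := mem_range.1 ht
      have h2 := mem_range.1 hi
      refine hf _ (by rw [mul_add]; omega) fun h => ?_
      rw [add_assoc, Nat.dvd_add_right (dvd_mul_right d l)] at h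
      exact absurd (Nat.le_of_dvd (by omega) h) (by omega)
    rw [sum_congr rfl fun t ht => by rw [hP t ht, pow_add, mul_right_comm], ← mul_sum, hx', mul_zero]

end NilpotentExpansion

section Reduction

variable {P : ℚ[X]}

/-- `ReducesTo P a α` says that the rational function `a` is regular at the roots of `P` and that
its residue modulo `P` is `α`. -/
def ReducesTo (P : ℚ[X]) (a : RatFunc ℚ) (α : AdjoinRoot P) : Prop :=
  ∃ s t : ℚ[X], t ≠ 0 ∧ IsCoprime t P ∧
    a = algebraMap ℚ[X] (RatFunc ℚ) s / algebraMap ℚ[X] (RatFunc ℚ) t ∧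
    α * AdjoinRoot.mk P t = AdjoinRoot.mk P s

theorem algebraMap_ratFunc_ne_zero {t : ℚ[X]} (ht : t ≠ 0) :
    algebraMap ℚ[X] (RatFunc ℚ) t ≠ 0 := by
  simpa using ht

theorem reducesTo_algebraMap (p : ℚ[X]) :
    ReducesTo P (algebraMap ℚ[X] (RatFunc ℚ) p) (AdjoinRoot.mk P p) :=
  ⟨p, 1, one_ne_zero, isCoprime_one_left, by simp, by simp⟩

namespace ReducesTo

variable {a b : RatFunc ℚ} {α β : AdjoinRoot P}

theorem add (ha : ReducesTo P a α) (hb : ReducesTo P b β) : ReducesTo P (a + b) (α + β) := by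
  obtain ⟨s, t, ht, hc, rfl, h⟩ := ha
  obtain ⟨s', t', ht', hc', rfl, h'⟩ := hb
  refine ⟨s * t' + t * s', t * t', mul_ne_zero ht ht', hc.mul_left hc', ?_, ?_⟩
  · rw [div_add_div _ _ (algebraMap_ratFunc_ne_zero ht) (algebraMap_ratFunc_ne_zero ht')]
    simp
  · simp only [map_mul, map_add, ← h, ← h']
    ring

theorem mul (ha : ReducesTo P a α) (hb : ReducesTo P b β) : ReducesTo P (a * b) (α * β) := by
  obtain ⟨s, t, ht, hc, rfl, h⟩ := ha
  obtain ⟨s', t', ht', hc', rfl, h'⟩ := hb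
  refine ⟨s * s', t * t', mul_ne_zero ht ht', hc.mul_left hc', ?_, ?_⟩
  · rw [div_mul_div_comm]
    simp
  · simp only [map_mul, ← h, ← h']
    ring

theorem one : ReducesTo P 1 1 := by
  simpa using reducesTo_algebraMap (P := P) 1

theorem neg (ha : ReducesTo P a α) : ReducesTo P (-a) (-α) := by
  simpa using (reducesTo_algebraMap (P := P) (-1)).mul ha

theorem sub (ha : ReducesTo P a α) (hb : ReducesTo P b β) : ReducesTo P (a - b) (α - β) := by
  simpa [sub_eq_add_neg] using ha.add hb.neg

theorem pow (ha : ReducesTo P a α) (k : ℕ) : ReducesTo P (a ^ k) (α ^ k) := by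
  induction k with
  | zero => simpa using one
  | succ k ih => simpa only [pow_succ] using ih.mul ha

theorem sum {ι : Type*} {s : Finset ι} {a : ι → RatFunc ℚ} {α : ι → AdjoinRoot P}
    (h : ∀ i ∈ s, ReducesTo P (a i) (α i)) : ReducesTo P (∑ i ∈ s, a i) (∑ i ∈ s, α i) := by
  classical
  induction s using Finset.induction_on with
  | empty => simpa using reducesTo_algebraMap (P := P) 0
  | insert i s hi ih =>
    rw [sum_insert hi, sum_insert hi]
    exact (h i (mem_insert_self i s)).add (ih fun j hj => h j (mem_insert_of_mem hj))

theorem prod {ι : Type*} {s : Finset ι} {a : ι → RatFunc ℚ} {α : ι → (AdjoinRoot P)ˣ}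
    (h : ∀ i ∈ s, ReducesTo P (a i) (α i)) :
    ReducesTo P (∏ i ∈ s, a i) ((∏ i ∈ s, α i : (AdjoinRoot P)ˣ) : AdjoinRoot P) := by
  classical
  induction s using Finset.induction_on with
  | empty => simpa using one
  | insert i s hi ih =>
    rw [prod_insert hi, prod_insert hi, Units.val_mul]
    exact (h i (mem_insert_self i s)).mul (ih fun j hj => h j (mem_insert_of_mem hj))

theorem inv (hP : ¬ IsUnit P) {α : (AdjoinRoot P)ˣ} (ha : ReducesTo P a α) :
    ReducesTo P a⁻¹ ((α⁻¹ : (AdjoinRoot P)ˣ) : AdjoinRoot P) := by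
  obtain ⟨s, t, ht, ⟨u, v, hc⟩, rfl, h⟩ := ha
  obtain ⟨p, hp⟩ := AdjoinRoot.mk_surjective ((α⁻¹ : (AdjoinRoot P)ˣ) : AdjoinRoot P)
  have hcop : IsCoprime s P := by
    have h1 : AdjoinRoot.mk P (p * u * s - 1) = 0 := by
      have h2 := congrArg (AdjoinRoot.mk P) hc
      simp only [map_add, map_mul, AdjoinRoot.mk_self, mul_zero, add_zero, map_one] at h2
      simp only [map_sub, map_mul, map_one, hp, ← h]
      linear_combination h2 + AdjoinRoot.mk P u * AdjoinRoot.mk P t * α.inv_mul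
    obtain ⟨c, h2⟩ := AdjoinRoot.mk_eq_zero.1 h1
    exact ⟨p * u, -c, by linear_combination h2⟩
  refine ⟨t, s, ?_, hcop, by rw [inv_div], ?_⟩
  · rintro rfl
    exact hP (isCoprime_zero_left.1 hcop)
  · rw [← h, ← mul_assoc, α.inv_mul, one_mul]

theorem zpow (hP : ¬ IsUnit P) {α : (AdjoinRoot P)ˣ} (ha : ReducesTo P a α) (m : ℤ) :
    ReducesTo P (a ^ m) ((α ^ m : (AdjoinRoot P)ˣ) : AdjoinRoot P) := by
  obtain ⟨k, rfl | rfl⟩ := m.eq_nat_or_neg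
  · simpa using ha.pow k
  · rw [zpow_neg, zpow_neg, zpow_natCast, zpow_natCast]
    exact inv hP (by simpa using ha.pow k)

theorem ratModEq (ha : ReducesTo P a α) (hb : ReducesTo P b α) : ratModEq P a b := by
  obtain ⟨s, t, -, hc, hab, h⟩ := ha.sub hb
  refine ⟨s, t, hc, ?_, hab⟩
  rwa [sub_self, zero_mul, eq_comm, AdjoinRoot.mk_eq_zero] at h

end ReducesTo

theorem exists_unit_eq_mk {p : ℚ[X]} (h : IsCoprime p P) :
    ∃ α : (AdjoinRoot P)ˣ, (α : AdjoinRoot P) = AdjoinRoot.mk P p := by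
  obtain ⟨u, v, huv⟩ := h
  have h1 := congrArg (AdjoinRoot.mk P) huv
  simp only [map_add, map_mul, AdjoinRoot.mk_self, mul_zero, add_zero, map_one] at h1
  exact ⟨Units.mkOfMulEqOne _ _ ((mul_comm _ _).trans h1), rfl⟩

theorem ratModEq_iff {a b : RatFunc ℚ} (hP : ¬ IsUnit P) :
    ratModEq P a b ↔ P ∣ (a - b).num ∧ IsCoprime (a - b).denom P := by
  constructor
  · rintro ⟨s, t, hc, hs, h⟩
    have ht : t ≠ 0 := by
      rintro rfl
      exact hP (isCoprime_zero_left.1 hc)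
    have hden : IsCoprime (a - b).denom P :=
      hc.of_isCoprime_of_dvd_left (h ▸ RatFunc.denom_div_dvd s t)
    refine ⟨hc.symm.dvd_of_dvd_mul_right ?_, hden⟩
    rw [(RatFunc.num_mul_eq_mul_denom_iff ht).2 h]
    exact hs.mul_right _
  · rintro ⟨h1, h2⟩
    exact ⟨_, _, h2, h1, (RatFunc.num_div_denom _).symm⟩

end Reduction

section QBinomial

theorem one_sub_q_pow_eq (j : ℕ) :
    1 - q ^ j = algebraMap ℚ[X] (RatFunc ℚ) (1 - X ^ j) := by
  simp [q]

theorem one_sub_X_pow_ne_zero {j : ℕ} (hj : 0 < j) : (1 - X ^ j : ℚ[X]) ≠ 0 := by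
  rw [← neg_sub, neg_ne_zero]
  exact X_pow_sub_C_ne_zero hj 1

theorem q_ne_zero : q ≠ 0 := RatFunc.X_ne_zero

theorem one_sub_q_pow_ne_zero {j : ℕ} (hj : 0 < j) : 1 - q ^ j ≠ 0 := by
  rw [one_sub_q_pow_eq]
  exact algebraMap_ratFunc_ne_zero (one_sub_X_pow_ne_zero hj)

/-- The ratio of consecutive terms of `[n+k choose k] [n-1 choose k]`, up to a sign and a power
of `q`. -/
noncomputable def qbinomRatio (n j : ℕ) : RatFunc ℚ :=
  -((1 - q ^ (n + j)) * (1 - q ^ (n - j))) / (q ^ (n - j) * (1 - q ^ j) ^ 2)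

theorem qPoch_succ (m : ℕ) : qPoch (m + 1) = qPoch m * (1 - q ^ (m + 1)) :=
  prod_range_succ _ _

theorem qPoch_ne_zero (m : ℕ) : qPoch m ≠ 0 :=
  prod_ne_zero_iff.2 fun i _ => one_sub_q_pow_ne_zero i.succ_pos

theorem qbinom_mul_qbinom (n k : ℕ) (hk : k < n) :
    qbinom (n + k) k * qbinom (n - 1) k =
      ∏ i ∈ range k, (-q ^ (n - (i + 1)) * qbinomRatio n (i + 1)) := by
  induction k with
  | zero =>
    have h := qPoch_ne_zero n
    have h' := qPoch_ne_zero (n - 1)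
    simp [qbinom, qPoch] at h h' ⊢
    field_simp
  | succ k ih =>
    rw [prod_range_succ, ← ih (by omega)]
    obtain ⟨m, rfl⟩ : ∃ m, n = k + 1 + (m + 1) := ⟨n - k - 2, by omega⟩
    have e1 : k + 1 + (m + 1) - (k + 1) = m + 1 := by omega
    have e2 : k + 1 + (m + 1) + (k + 1) - (k + 1) = k + 1 + (m + 1) := by omega
    have e3 : k + 1 + (m + 1) + k - k = k + 1 + (m + 1) := by omega
    have e4 : k + 1 + (m + 1) - 1 - (k + 1) = m := by omega
    have e5 : k + 1 + (m + 1) - 1 - k = m + 1 := by omega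
    rw [qbinom, qbinom, qbinom, qbinom, if_pos (by omega), if_pos (by omega), if_pos (by omega),
      if_pos (by omega), qbinomRatio, e1, e2, e3, e4, e5, ← add_assoc _ k 1, qPoch_succ (_ + k),
      qPoch_succ k, qPoch_succ m]
    have h1 := qPoch_ne_zero k
    have h2 := qPoch_ne_zero m
    have h3 := qPoch_ne_zero (k + 1 + (m + 1))
    have h4 := one_sub_q_pow_ne_zero k.succ_pos
    have h5 := one_sub_q_pow_ne_zero m.succ_pos
    have h6 := q_ne_zero
    rw [Nat.succ_eq_add_one] at h4 h5
    field_simp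

theorem prod_neg_q_pow_sq (n k : ℕ) (hk : k ≤ n) :
    (∏ i ∈ range k, (-q ^ (n - (i + 1)))) ^ 2 = q ^ (2 * (n : ℤ) * k - k * (k + 1)) := by
  induction k with
  | zero => simp
  | succ k ih =>
    rw [prod_range_succ, mul_pow, ih (by omega), neg_sq, ← pow_mul, ← zpow_natCast,
      ← zpow_add₀ q_ne_zero]
    congr 1
    push_cast [Nat.cast_sub hk]
    ring

theorem summand_eq (n k : ℕ) (hk : k < n) (r : ℤ) :
    q ^ (r * ((n : ℤ) - (k : ℤ)) ^ 2 + (r - 1) * (k : ℤ)) *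
        qbinom (n + k) k ^ (2 * r) * qbinom (n - 1) k ^ (2 * r) =
      q ^ (r * (n : ℤ) ^ 2) *
        (q⁻¹ ^ k * (∏ i ∈ range k, qbinomRatio n (i + 1)) ^ (2 * r)) := by
  rw [mul_assoc, ← mul_zpow, qbinom_mul_qbinom n k hk, prod_mul_distrib, mul_zpow, zpow_mul _ 2 r]
  have h := prod_neg_q_pow_sq n k hk.le
  rw [← zpow_natCast, Nat.cast_ofNat] at h
  rw [h, ← zpow_mul, ← mul_assoc, ← mul_assoc, ← zpow_add₀ q_ne_zero, ← zpow_natCast, inv_zpow',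
    ← zpow_add₀ q_ne_zero]
  congr 2
  ring

end QBinomial

section Cyclotomic

variable {d : ℕ}

theorem isCoprime_X_cyclotomic (hd : 0 < d) : IsCoprime X (cyclotomic d ℚ) := by
  refine IsCoprime.of_isCoprime_of_dvd_right (y := X ^ d - 1) ?_ (cyclotomic.dvd_X_pow_sub_one d ℚ)
  obtain ⟨m, rfl⟩ : ∃ m, d = m + 1 := ⟨d - 1, by omega⟩
  exact ⟨X ^ m, -1, by ring⟩

theorem isCoprime_one_sub_X_pow_cyclotomic {j : ℕ} (hj : 0 < j) (hdj : ¬ d ∣ j) :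
    IsCoprime (1 - X ^ j) (cyclotomic d ℚ) := by
  rw [← neg_sub, IsCoprime.neg_left_iff, ← prod_cyclotomic_eq_X_pow_sub_one hj]
  refine IsCoprime.prod_left fun i hi => cyclotomic.isCoprime_rat ?_
  rintro rfl
  exact hdj (Nat.dvd_of_mem_divisors hi)

theorem isCoprime_geom_sum_cyclotomic (d : ℕ) {l : ℕ} (hd : 0 < d) (hl : 0 < l) :
    IsCoprime (∑ i ∈ range l, (X ^ d : ℚ[X]) ^ i) (cyclotomic d ℚ) := by
  have h : (X ^ (d * l) - 1 : ℚ[X]).Separable := by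
    rw [X_pow_sub_one_separable_iff]
    exact_mod_cast (Nat.mul_pos hd hl).ne'
  rw [pow_mul, ← geom_sum_mul] at h
  exact h.isCoprime.of_isCoprime_of_dvd_right (cyclotomic.dvd_X_pow_sub_one d ℚ)

theorem exists_isCoprime_cyclotomic_mul_eq (hd : 0 < d) {j : ℕ} (hj : 0 < j) :
    ∃ p : ℚ[X], IsCoprime p (cyclotomic d ℚ) ∧
      1 - X ^ j = p * if d ∣ j then 1 - X ^ d else 1 := by
  by_cases hdj : d ∣ j
  · obtain ⟨l, rfl⟩ := hdj
    refine ⟨_, isCoprime_geom_sum_cyclotomic d hd (Nat.pos_of_mul_pos_left hj), ?_⟩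
    rw [if_pos (dvd_mul_right d l), pow_mul, geom_sum_mul_neg]
  · exact ⟨_, isCoprime_one_sub_X_pow_cyclotomic hj hdj, by rw [if_neg hdj, mul_one]⟩

theorem not_isUnit_cyclotomic_pow (hd : 0 < d) {m : ℕ} (hm : m ≠ 0) :
    ¬ IsUnit (cyclotomic d ℚ ^ m) := by
  rw [isUnit_pow_iff hm]
  exact (cyclotomic.irreducible_rat hd).not_isUnit

theorem exists_reducesTo_qbinomRatio {n j m : ℕ} (hm : m ≠ 0) (hd : 0 < d) (hdn : d ∣ n)
    (hj : 0 < j) (hjn : j < n) {P : ℚ[X]} (hPd : P = cyclotomic d ℚ ^ m) {x : (AdjoinRoot P)ˣ}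
    (hx : (x : AdjoinRoot P) = AdjoinRoot.mk P X) :
    ∃ f : (AdjoinRoot P)ˣ, ReducesTo P (qbinomRatio n j) f ∧
      (¬ d ∣ j → ∀ w : (AdjoinRoot P)ˣ, (w : AdjoinRoot P) = 1 - (x : AdjoinRoot P) ^ j →
        (f : AdjoinRoot P) = 1 - (1 - (x : AdjoinRoot P) ^ n) ^ 2 *
          ((x ^ n)⁻¹ : (AdjoinRoot P)ˣ) *
            ((x : AdjoinRoot P) ^ j * (w⁻¹ : (AdjoinRoot P)ˣ) ^ 2)) := by
  have hP : ¬ IsUnit P := hPd ▸ not_isUnit_cyclotomic_pow hd hm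
  obtain ⟨p₁, hp₁, h₁⟩ := exists_isCoprime_cyclotomic_mul_eq hd hj
  obtain ⟨p₂, hp₂, h₂⟩ := exists_isCoprime_cyclotomic_mul_eq hd (j := n + j) (by omega)
  obtain ⟨p₃, hp₃, h₃⟩ := exists_isCoprime_cyclotomic_mul_eq hd (j := n - j) (by omega)
  obtain ⟨α₁, hα₁⟩ := exists_unit_eq_mk (P := P) (hPd ▸ hp₁.pow_right)
  obtain ⟨α₂, hα₂⟩ := exists_unit_eq_mk (P := P) (hPd ▸ hp₂.pow_right)
  obtain ⟨α₃, hα₃⟩ := exists_unit_eq_mk (P := P) (hPd ▸ hp₃.pow_right)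
  have hdvd₂ : d ∣ n + j ↔ d ∣ j := Nat.dvd_add_right hdn
  have hdvd₃ : d ∣ n - j ↔ d ∣ j := Nat.dvd_sub_iff_right hjn.le hdn
  simp only [hdvd₂] at h₂
  simp only [hdvd₃] at h₃
  refine ⟨-(α₂ * α₃) * (x ^ (n - j) * α₁ ^ 2)⁻¹, ?_, ?_⟩
  · have hc : algebraMap ℚ[X] (RatFunc ℚ) (if d ∣ j then 1 - X ^ d else 1) ≠ 0 := by
      refine algebraMap_ratFunc_ne_zero ?_
      split_ifs
      exacts [one_sub_X_pow_ne_zero hd, one_ne_zero]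
    have heq : qbinomRatio n j = -(algebraMap ℚ[X] (RatFunc ℚ) p₂ * algebraMap ℚ[X] (RatFunc ℚ) p₃) *
        (algebraMap ℚ[X] (RatFunc ℚ) X ^ (n - j) * algebraMap ℚ[X] (RatFunc ℚ) p₁ ^ 2)⁻¹ := by
      rw [qbinomRatio, one_sub_q_pow_eq, one_sub_q_pow_eq, one_sub_q_pow_eq, h₁, h₂, h₃,
        map_mul, map_mul, map_mul, q, RatFunc.algebraMap_X, ← div_eq_mul_inv, ← mul_div_mul_right _
        (RatFunc.X ^ (n - j) * algebraMap ℚ[X] (RatFunc ℚ) p₁ ^ 2) (pow_ne_zero 2 hc)]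
      congr 1 <;> ring
    have hr₁ := hα₁ ▸ reducesTo_algebraMap (P := P) p₁
    have hr₂ := hα₂ ▸ reducesTo_algebraMap (P := P) p₂
    have hr₃ := hα₃ ▸ reducesTo_algebraMap (P := P) p₃
    have hrx := hx ▸ reducesTo_algebraMap (P := P) X
    rw [heq, Units.val_mul, Units.val_neg, Units.val_mul]
    exact (hr₂.mul hr₃).neg.mul (.inv hP (by simpa using (hrx.pow (n - j)).mul (hr₁.pow 2)))
  · intro hdj w hw
    rw [if_neg hdj, mul_one] at h₁ h₂ h₃
    rw [← h₁, map_sub, map_one, map_pow, ← hx] at hα₁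
    rw [← h₂, map_sub, map_one, map_pow, ← hx, pow_add] at hα₂
    rw [← h₃, map_sub, map_one, map_pow, ← hx] at hα₃
    obtain rfl : α₁ = w := Units.ext (hα₁.trans hw.symm)
    have hn : (x : AdjoinRoot P) ^ n = x ^ (n - j) * x ^ j := by
      rw [← pow_add, Nat.sub_add_cancel hjn.le]
    have h4 := (x ^ (n - j) * α₁ ^ 2).mul_inv
    have h5 := (x ^ n).mul_inv
    have h6 := α₁.mul_inv
    refine (x ^ n * α₁ ^ 2).isUnit.mul_left_cancel ?_
    simp only [Units.val_mul, Units.val_neg, Units.val_pow_eq_pow_val, hα₂, hα₃] at h4 h5 ⊢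
    rw [hn] at h5 ⊢
    rw [hα₁] at h4 h6 ⊢
    generalize ((x ^ n)⁻¹ : (AdjoinRoot P)ˣ).val = g at *
    generalize (α₁⁻¹ : (AdjoinRoot P)ˣ).val = a at *
    generalize ((x ^ (n - j) * α₁ ^ 2)⁻¹ : (AdjoinRoot P)ˣ).val = b at *
    generalize (x : AdjoinRoot P) ^ (n - j) = y at *
    generalize (x : AdjoinRoot P) ^ j = z at *
    linear_combination (-z * (1 - y * z * z) * (1 - y)) * h4 +
      (1 - y * z) ^ 2 * z * (1 - z) ^ 2 * a ^ 2 * h5 +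
      (1 - y * z) ^ 2 * z * ((1 - z) * a + 1) * h6

end Cyclotomic

section Congruences

theorem ReducesTo.sum_qbinomRatio {P : ℚ[X]} (hP : ¬ IsUnit P) {n : ℕ} {x : (AdjoinRoot P)ˣ}
    (hx : ReducesTo P q x) {f : ℕ → (AdjoinRoot P)ˣ}
    (hf : ∀ j, 0 < j → j < n → ReducesTo P (qbinomRatio n j) (f j)) (a s : ℤ) :
    ReducesTo P
      (q ^ a * ∑ k ∈ range n, q⁻¹ ^ k * (∏ i ∈ range k, qbinomRatio n (i + 1)) ^ s)
      (((x ^ a : (AdjoinRoot P)ˣ) : AdjoinRoot P) * ∑ k ∈ range n,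
        ((x⁻¹ : (AdjoinRoot P)ˣ) : AdjoinRoot P) ^ k *
          (((∏ i ∈ range k, f (i + 1)) ^ s : (AdjoinRoot P)ˣ) : AdjoinRoot P)) := by
  refine (hx.zpow hP a).mul (.sum fun k hk => ((hx.inv hP).pow k).mul (.zpow hP (.prod ?_) s))
  intro i hi
  have h1 := mem_range.1 hk
  have h2 := mem_range.1 hi
  exact hf (i + 1) i.succ_pos (by omega)

theorem ReducesTo.qintR_terms {P : ℚ[X]} (hP : ¬ IsUnit P) (n : ℕ) {x : (AdjoinRoot P)ˣ}
    (hx : ReducesTo P q x) (a : ℤ) (c : ℚ) :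
    ReducesTo P (q ^ a * qintR n - RatFunc.C c * q * (1 - q) ^ 2 * qintR n ^ 3)
      (((x ^ a : (AdjoinRoot P)ˣ) : AdjoinRoot P) * AdjoinRoot.mk P (qint n) -
        algebraMap ℚ (AdjoinRoot P) c * x * (1 - x) ^ 2 * AdjoinRoot.mk P (qint n) ^ 3) := by
  have hN : ReducesTo P (qintR n) (AdjoinRoot.mk P (qint n)) := reducesTo_algebraMap _
  have hc : ReducesTo P (RatFunc.C c) (algebraMap ℚ (AdjoinRoot P) c) := by
    have h := reducesTo_algebraMap (P := P) (C c)
    rwa [RatFunc.algebraMap_C, AdjoinRoot.mk_C, ← AdjoinRoot.algebraMap_eq] at h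
  exact ((hx.zpow hP a).mul hN).sub (((hc.mul hx).mul ((one.sub hx).pow 2)).mul (hN.pow 3))

theorem ratModEq_cyclotomic_pow_four {n : ℕ} (hn : 2 ≤ n) (r : ℤ) :
    ratModEq (cyclotomic n ℚ ^ 4)
      (q ^ (r * (n : ℤ) ^ 2) *
        ∑ k ∈ range n, q⁻¹ ^ k * (∏ i ∈ range k, qbinomRatio n (i + 1)) ^ (2 * r))
      (q ^ ((r - 1) * (n : ℤ) + 1) * qintR n -
        RatFunc.C (((r * (2 * r - 1) * ((n : ℤ) - 1) ^ 2 : ℤ) : ℚ) / 4) *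
          q * (1 - q) ^ 2 * qintR n ^ 3) := by
  have hn0 : 0 < n := by omega
  obtain ⟨P, hPd⟩ : ∃ P, P = cyclotomic n ℚ ^ 4 := ⟨_, rfl⟩
  have hP : ¬ IsUnit P := hPd ▸ not_isUnit_cyclotomic_pow hn0 four_ne_zero
  rw [← hPd]
  obtain ⟨x, hx⟩ := exists_unit_eq_mk (P := P) (hPd ▸ (isCoprime_X_cyclotomic hn0).pow_right)
  have hxq : ReducesTo P q x := by
    have h := reducesTo_algebraMap (P := P) X
    rwa [RatFunc.algebraMap_X, ← hx] at h
  have hndvd : ∀ j, 0 < j → j < n → ¬ n ∣ j := fun j hj hjn => Nat.not_dvd_of_pos_of_lt hj hjn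
  have hw : ∀ j, ∃ w : (AdjoinRoot P)ˣ, 0 < j → j < n →
      (w : AdjoinRoot P) = 1 - (x : AdjoinRoot P) ^ j := by
    intro j
    by_cases hj : 0 < j ∧ j < n
    · obtain ⟨w, hw⟩ := exists_unit_eq_mk (P := P)
        (hPd ▸ (isCoprime_one_sub_X_pow_cyclotomic hj.1 (hndvd j hj.1 hj.2)).pow_right)
      exact ⟨w, fun _ _ => by rw [hw, hx]; simp⟩
    · exact ⟨1, fun h1 h2 => absurd ⟨h1, h2⟩ hj⟩
  choose w hw using hw
  have hf : ∀ j, ∃ f : (AdjoinRoot P)ˣ, 0 < j → j < n → ReducesTo P (qbinomRatio n j) f ∧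
      (f : AdjoinRoot P) = 1 - (1 - (x : AdjoinRoot P) ^ n) ^ 2 *
        ((x ^ n)⁻¹ : (AdjoinRoot P)ˣ) *
          ((x : AdjoinRoot P) ^ j * ((w j)⁻¹ : (AdjoinRoot P)ˣ) ^ 2) := by
    intro j
    by_cases hj : 0 < j ∧ j < n
    · obtain ⟨f, h1, h2⟩ :=
        exists_reducesTo_qbinomRatio four_ne_zero hn0 dvd_rfl hj.1 hj.2 hPd hx
      exact ⟨f, fun _ _ => ⟨h1, h2 (hndvd j hj.1 hj.2) _ (hw j hj.1 hj.2)⟩⟩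
    · exact ⟨1, fun h1 h2 => absurd ⟨h1, h2⟩ hj⟩
  choose f hf using hf
  have hN : (1 - (x : AdjoinRoot P)) * AdjoinRoot.mk P (qint n) = 1 - (x : AdjoinRoot P) ^ n := by
    rw [hx, qint, map_sum]
    simp only [map_pow]
    exact mul_neg_geom_sum _ n
  have he : (1 - (x : AdjoinRoot P) ^ n) ^ 4 = 0 := by
    rw [hx, ← map_pow, ← map_one (AdjoinRoot.mk P), ← map_sub, ← map_pow, AdjoinRoot.mk_eq_zero,
      hPd, ← neg_sub, Even.neg_pow (by decide)]
    exact pow_dvd_pow_of_dvd (cyclotomic.dvd_X_pow_sub_one n ℚ) 4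
  have hlhs := ReducesTo.sum_qbinomRatio hP hxq (fun j h1 h2 => (hf j h1 h2).1)
    (r * (n : ℤ) ^ 2) (2 * r)
  rw [sum_inv_pow_mul_prod_zpow hn r he hN hw fun j h1 h2 => (hf j h1 h2).2] at hlhs
  exact hlhs.ratModEq (.qintR_terms hP n hxq _ _)

theorem qint_eq_prod {n : ℕ} (hn : 0 < n) :
    qint n = ∏ d ∈ n.divisors.erase 1, cyclotomic d ℚ :=
  (prod_cyclotomic_eq_geom_sum hn ℚ).symm

theorem ratModEq_cyclotomic_of_dvd {n d : ℕ} (hd : 1 < d) (hdn : d ∣ n) (hn : 0 < n)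
    (r : ℤ) (c : ℚ) :
    ratModEq (cyclotomic d ℚ)
      (q ^ (r * (n : ℤ) ^ 2) *
        ∑ k ∈ range n, q⁻¹ ^ k * (∏ i ∈ range k, qbinomRatio n (i + 1)) ^ (2 * r))
      (q ^ ((r - 1) * (n : ℤ) + 1) * qintR n - RatFunc.C c * q * (1 - q) ^ 2 * qintR n ^ 3) := by
  have hd0 : 0 < d := by omega
  obtain ⟨P, hPd⟩ : ∃ P, P = cyclotomic d ℚ := ⟨_, rfl⟩
  have hP : ¬ IsUnit P := hPd ▸ (cyclotomic.irreducible_rat hd0).not_isUnit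
  rw [← hPd]
  obtain ⟨x, hx⟩ := exists_unit_eq_mk (P := P) (hPd ▸ isCoprime_X_cyclotomic hd0)
  have hxq : ReducesTo P q x := by
    have h := reducesTo_algebraMap (P := P) X
    rwa [RatFunc.algebraMap_X, ← hx] at h
  have hgeom : ∀ {l : ℕ}, 0 < l → d ∣ l → AdjoinRoot.mk P (qint l) = 0 := by
    intro l hl hdl
    rw [AdjoinRoot.mk_eq_zero, hPd, qint_eq_prod hl]
    exact dvd_prod_of_mem _ (mem_erase.2 ⟨hd.ne', Nat.mem_divisors.2 ⟨hdl, hl.ne'⟩⟩)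
  have hsum : ∑ i ∈ range d, (x : AdjoinRoot P) ^ i = 0 := by
    rw [← hgeom hd0 dvd_rfl, hx, qint, map_sum]
    simp only [map_pow]
  have hxn : (x : AdjoinRoot P) ^ n = 1 := by
    obtain ⟨l, rfl⟩ := hdn
    have h := mul_neg_geom_sum (x : AdjoinRoot P) d
    rw [hsum, mul_zero, eq_comm, sub_eq_zero] at h
    rw [pow_mul, ← h, one_pow]
  have hf : ∀ j, ∃ f : (AdjoinRoot P)ˣ, (0 < j → j < n → ReducesTo P (qbinomRatio n j) f) ∧
      (j < n → ¬ d ∣ j → f = 1) := by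
    intro j
    by_cases hj : 0 < j ∧ j < n
    · obtain ⟨f, h1, h2⟩ := exists_reducesTo_qbinomRatio one_ne_zero hd0 hdn hj.1 hj.2
        (hPd.trans (pow_one _).symm) hx
      refine ⟨f, fun _ _ => h1, fun _ hdj => ?_⟩
      obtain ⟨w, hw⟩ := exists_unit_eq_mk (P := P)
        (hPd ▸ isCoprime_one_sub_X_pow_cyclotomic hj.1 hdj)
      have h3 := h2 hdj w (by rw [hw, hx]; simp)
      rw [hxn] at h3
      exact Units.ext (by simpa using h3)
    · refine ⟨1, fun h1 h2 => absurd ⟨h1, h2⟩ hj, fun _ _ => rfl⟩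
  choose f hf1 hf2 using hf
  have hlhs := ReducesTo.sum_qbinomRatio hP hxq hf1 (r * (n : ℤ) ^ 2) (2 * r)
  have hrhs := ReducesTo.qintR_terms hP n hxq ((r - 1) * (n : ℤ) + 1) c
  rw [hgeom hn hdn, mul_zero, zero_pow three_ne_zero, mul_zero, sub_zero] at hrhs
  obtain ⟨l, rfl⟩ := hdn
  rw [sum_inv_pow_mul_prod_zpow_eq_zero hsum (2 * r) l hf2, mul_zero] at hlhs
  exact hlhs.ratModEq hrhs

theorem ratModEq_mul_prod {ι : Type*} {s : Finset ι} {p : ι → ℚ[X]} {P : ℚ[X]} {a b : RatFunc ℚ}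
    (hP : ¬ IsUnit P) (hp : ∀ i ∈ s, ¬ IsUnit (p i))
    (hcop : (s : Set ι).Pairwise (Function.onFun IsCoprime p)) (hPp : ∀ i ∈ s, IsCoprime P (p i))
    (h : ratModEq P a b) (hs : ∀ i ∈ s, ratModEq (p i) a b) :
    ratModEq (P * ∏ i ∈ s, p i) a b := by
  have h1 := (ratModEq_iff hP).1 h
  have h2 := fun i hi => (ratModEq_iff (hp i hi)).1 (hs i hi)
  exact ⟨_, _, h1.2.mul_right (.prod_right fun i hi => (h2 i hi).2),
    (IsCoprime.prod_right hPp).mul_dvd h1.1 (Finset.prod_dvd_of_coprime hcop fun i hi => (h2 i hi).1),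
    (RatFunc.num_div_denom _).symm⟩

end Congruences

/-- **Guo–Schlosser–Zudilin conjecture** (Theorem 1.1): for a positive integer `n` and an
arbitrary integer `r`,
`∑_{k=0}^{n-1} q^{r(n-k)²+(r-1)k} [n+k choose k]^{2r} [n-1 choose k]^{2r}
  ≡ q^{(r-1)n+1}[n] - (r(2r-1)(n-1)²/4) q (1-q)² [n]³  (mod [n] Φ_n(q)³)`. -/
theorem guo_schlosser_zudilin (n : ℕ) (hn : 0 < n) (r : ℤ) :
    ratModEq (qint n * (Polynomial.cyclotomic n ℚ) ^ 3)
      (∑ k ∈ Finset.range n,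
        q ^ (r * ((n : ℤ) - (k : ℤ)) ^ 2 + (r - 1) * (k : ℤ)) *
          qbinom (n + k) k ^ (2 * r) * qbinom (n - 1) k ^ (2 * r))
      (q ^ ((r - 1) * (n : ℤ) + 1) * qintR n -
        RatFunc.C (((r * (2 * r - 1) * ((n : ℤ) - 1) ^ 2 : ℤ) : ℚ) / 4) *
          q * (1 - q) ^ 2 * qintR n ^ 3) := by
  obtain rfl | hn2 : n = 1 ∨ 2 ≤ n := by omega
  · refine ⟨0, 1, isCoprime_one_left, dvd_zero _, ?_⟩
    have h := one_sub_q_pow_ne_zero one_pos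
    rw [pow_one] at h
    simp [qbinom, qPoch, qintR, qint, div_self h]
  rw [sum_congr rfl fun k hk => summand_eq n k (mem_range.1 hk) r, ← mul_sum]
  have hmod : qint n * cyclotomic n ℚ ^ 3 =
      cyclotomic n ℚ ^ 4 * ∏ d ∈ (n.divisors.erase 1).erase n, cyclotomic d ℚ := by
    have hmem : n ∈ n.divisors.erase 1 := by simp; omega
    rw [qint_eq_prod hn, ← mul_prod_erase _ _ hmem]
    ring
  rw [hmod]
  have hdvd : ∀ d ∈ (n.divisors.erase 1).erase n, d ≠ n ∧ 1 < d ∧ d ∣ n := by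
    intro d hd
    obtain ⟨h1, h2, h3⟩ : d ≠ n ∧ d ≠ 1 ∧ d ∈ n.divisors := by simpa only [mem_erase] using hd
    have h4 := Nat.pos_of_mem_divisors h3
    exact ⟨h1, by omega, Nat.dvd_of_mem_divisors h3⟩
  refine ratModEq_mul_prod (not_isUnit_cyclotomic_pow hn four_ne_zero) (fun d hd => ?_)
    (fun i _ j _ hij => cyclotomic.isCoprime_rat hij)
    (fun d hd => (cyclotomic.isCoprime_rat (hdvd d hd).1.symm).pow_left)
    (ratModEq_cyclotomic_pow_four hn2 r)
    fun d hd => ratModEq_cyclotomic_of_dvd (hdvd d hd).2.1 (hdvd d hd).2.2 hn r _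
  have hd1 := (hdvd d hd).2.1
  exact (cyclotomic.irreducible_rat (by omega)).not_isUnit
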